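/- arXiv:1512.00404 — 2 statements merged into one kernel-verified Lean document; each statement's English description precedes it below -/
import Mathlib

section
/- For an intra-regular po-Γ-semigroup M, the set {(x)_𝒩 : x ∈ M} coincides with the set of all maximal simple subsemigroups of M. -/
namespace PGS

variable {M : Type*} {Γ : Type*}

/-- `AΓB = {aγb : a ∈ A, b ∈ B, γ ∈ Γ}`. -/
def gprod (op : Γ → M → M → M) (A B : Set M) : Set M :=
  {x | ∃ a ∈ A, ∃ b ∈ B, ∃ γ : Γ, x = op γ a b}

/-- `(H] = {t : t ≤ h for some h ∈ H}`. -/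
def dcl [PartialOrder M] (H : Set M) : Set M :=
  {t | ∃ h ∈ H, t ≤ h}

/-- `M` with the family of operations `op : Γ → M → M → M` and the partial order `≤`
is a po-Γ-semigroup: `(aγb)μc = aγ(bμc)` and the order is compatible with the operations. -/
def IsPoGammaSemigroup [PartialOrder M] (op : Γ → M → M → M) : Prop :=
  (∀ (a b c : M) (γ μ : Γ), op μ (op γ a b) c = op γ a (op μ b c)) ∧
  (∀ (a b c : M) (γ : Γ), a ≤ b → op γ a c ≤ op γ b c) ∧
  (∀ (a b c : M) (γ : Γ), a ≤ b → op γ c a ≤ op γ c b)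

/-- Left ideal of `M`: `MΓA ⊆ A` and `A` is downward closed. -/
def IsLeftIdeal [PartialOrder M] (op : Γ → M → M → M) (A : Set M) : Prop :=
  gprod op Set.univ A ⊆ A ∧ ∀ a ∈ A, ∀ b : M, b ≤ a → b ∈ A

/-- Right ideal of `M`: `AΓM ⊆ A` and `A` is downward closed. -/
def IsRightIdeal [PartialOrder M] (op : Γ → M → M → M) (A : Set M) : Prop :=
  gprod op A Set.univ ⊆ A ∧ ∀ a ∈ A, ∀ b : M, b ≤ a → b ∈ A

/-- Ideal of `M`: both a left and a right ideal. -/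
def IsIdeal [PartialOrder M] (op : Γ → M → M → M) (A : Set M) : Prop :=
  IsLeftIdeal op A ∧ IsRightIdeal op A

/-- A prime subset: `aγb ∈ T` implies `a ∈ T` or `b ∈ T`. -/
def IsPrimeSubset (op : Γ → M → M → M) (T : Set M) : Prop :=
  ∀ (a b : M) (γ : Γ), op γ a b ∈ T → a ∈ T ∨ b ∈ T

/-- A semiprime subset: `aγa ∈ T` implies `a ∈ T`. -/
def IsSemiprimeSubset (op : Γ → M → M → M) (T : Set M) : Prop :=
  ∀ (a : M) (γ : Γ), op γ a a ∈ T → a ∈ T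

/-- A weakly prime subset: for all ideals `A`, `B` of `M` with `AΓB ⊆ T`,
`A ⊆ T` or `B ⊆ T`. -/
def IsWeaklyPrimeSubset [PartialOrder M] (op : Γ → M → M → M) (T : Set M) : Prop :=
  ∀ A B : Set M, IsIdeal op A → IsIdeal op B → gprod op A B ⊆ T → A ⊆ T ∨ B ⊆ T

/-- Intra-regular: `x ∈ (MΓ{xγx}ΓM]` for all `x`, `γ`. -/
def IsIntraRegular [PartialOrder M] (op : Γ → M → M → M) : Prop :=
  ∀ (x : M) (γ : Γ),
    x ∈ dcl (gprod op (gprod op Set.univ {op γ x x}) Set.univ)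

/-- Left regular: `x ∈ (MΓ{xγx}]` for all `x`, `γ`. -/
def IsLeftRegular [PartialOrder M] (op : Γ → M → M → M) : Prop :=
  ∀ (x : M) (γ : Γ), x ∈ dcl (gprod op Set.univ {op γ x x})

/-- Left duo: every left ideal of `M` is an ideal of `M`. -/
def IsLeftDuo [PartialOrder M] (op : Γ → M → M → M) : Prop :=
  ∀ A : Set M, IsLeftIdeal op A → IsIdeal op A

/-- A subsemigroup: a nonempty subset `T` with `TΓT ⊆ T`. -/
def IsSubsemigroup (op : Γ → M → M → M) (T : Set M) : Prop :=
  T.Nonempty ∧ gprod op T T ⊆ T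

/-- An ideal of a subsemigroup `T`: a nonempty subset `I` of `T` with `TΓI ⊆ I`,
`IΓT ⊆ I`, closed downward inside `T`. -/
def IsIdealOfSub [PartialOrder M] (op : Γ → M → M → M) (T I : Set M) : Prop :=
  I.Nonempty ∧ I ⊆ T ∧ gprod op T I ⊆ I ∧ gprod op I T ⊆ I ∧
    ∀ a ∈ I, ∀ b ∈ T, b ≤ a → b ∈ I

/-- A left ideal of a subsemigroup `T`: a nonempty subset `I` of `T` with `TΓI ⊆ I`,
closed downward inside `T`. -/
def IsLeftIdealOfSub [PartialOrder M] (op : Γ → M → M → M) (T I : Set M) : Prop :=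
  I.Nonempty ∧ I ⊆ T ∧ gprod op T I ⊆ I ∧ ∀ a ∈ I, ∀ b ∈ T, b ≤ a → b ∈ I

/-- A simple subsemigroup: a subsemigroup having no ideal other than itself. -/
def IsSimpleSub [PartialOrder M] (op : Γ → M → M → M) (T : Set M) : Prop :=
  IsSubsemigroup op T ∧ ∀ I : Set M, IsIdealOfSub op T I → I = T

/-- A left simple subsemigroup: a subsemigroup having no left ideal other than itself. -/
def IsLeftSimpleSub [PartialOrder M] (op : Γ → M → M → M) (T : Set M) : Prop :=
  IsSubsemigroup op T ∧ ∀ I : Set M, IsLeftIdealOfSub op T I → I = T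

/-- A filter of `M`: a subsemigroup `F` such that `aγb ∈ F` implies `a ∈ F` and `b ∈ F`,
and `F` is upward closed. -/
def IsFilterSub [PartialOrder M] (op : Γ → M → M → M) (F : Set M) : Prop :=
  IsSubsemigroup op F ∧ (∀ (a b : M) (γ : Γ), op γ a b ∈ F → a ∈ F ∧ b ∈ F) ∧
    ∀ a ∈ F, ∀ c : M, a ≤ c → c ∈ F

/-- `N(x)`: the least filter of `M` containing `x`. -/
def Nfil [PartialOrder M] (op : Γ → M → M → M) (x : M) : Set M :=
  ⋂₀ {F : Set M | IsFilterSub op F ∧ x ∈ F}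

/-- The `𝒩`-class `(x)_𝒩` of `x`, where `a 𝒩 b` iff `N(a) = N(b)`. -/
def Ncls [PartialOrder M] (op : Γ → M → M → M) (x : M) : Set M :=
  {y | Nfil op y = Nfil op x}

/-- `L(a) = ({a} ∪ MΓ{a}]`, the left ideal of `M` generated by `a`. -/
def Lgen [PartialOrder M] (op : Γ → M → M → M) (a : M) : Set M :=
  dcl ({a} ∪ gprod op Set.univ {a})

/-- `I(a) = ({a} ∪ MΓ{a} ∪ {a}ΓM ∪ MΓ{a}ΓM]`, the ideal of `M` generated by `a`. -/
def Igen [PartialOrder M] (op : Γ → M → M → M) (a : M) : Set M :=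
  dcl ({a} ∪ gprod op Set.univ {a} ∪ gprod op {a} Set.univ ∪
    gprod op (gprod op Set.univ {a}) Set.univ)

/-- A semilattice congruence on `M`. -/
def IsSemilatticeCong (op : Γ → M → M → M) (σ : M → M → Prop) : Prop :=
  Equivalence σ ∧
  (∀ (a b c : M) (γ : Γ), σ a b → σ (op γ a c) (op γ b c)) ∧
  (∀ (a b c : M) (γ : Γ), σ a b → σ (op γ c a) (op γ c b)) ∧
  (∀ (a b : M) (γ : Γ), σ (op γ a b) (op γ b a)) ∧
  (∀ (a : M) (γ : Γ), σ (op γ a a) a)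

/-- The `σ`-class of `x`. -/
def cls (σ : M → M → Prop) (x : M) : Set M := {y | σ y x}

/-- `M` is a semilattice of simple semigroups. -/
def IsSemilatticeOfSimple [PartialOrder M] (op : Γ → M → M → M) : Prop :=
  ∃ σ : M → M → Prop, IsSemilatticeCong op σ ∧ ∀ x : M, IsSimpleSub op (cls σ x)

/-- `M` is a semilattice of left simple semigroups. -/
def IsSemilatticeOfLeftSimple [PartialOrder M] (op : Γ → M → M → M) : Prop :=
  ∃ σ : M → M → Prop, IsSemilatticeCong op σ ∧ ∀ x : M, IsLeftSimpleSub op (cls σ x)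

/-- `M` is a chain of simple semigroups. -/
def IsChainOfSimple [PartialOrder M] (op : Γ → M → M → M) : Prop :=
  ∃ σ : M → M → Prop, IsSemilatticeCong op σ ∧ (∀ x : M, IsSimpleSub op (cls σ x)) ∧
    ∀ (x y : M) (γ : Γ), cls σ x = cls σ (op γ x y) ∨ cls σ y = cls σ (op γ x y)

/-- `x ∈ (MΓ{y}ΓM]`, written out in terms of elements. -/
def Below [PartialOrder M] (op : Γ → M → M → M) (x y : M) : Prop :=
  ∃ (u v : M) (γ μ : Γ), x ≤ op μ (op γ u y) v

section Below

variable [PartialOrder M] {op : Γ → M → M → M}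

theorem Below.of_le {x y z : M} (hxy : x ≤ y) : Below op y z → Below op x z := by
  rintro ⟨u, v, γ, μ, h⟩
  exact ⟨u, v, γ, μ, hxy.trans h⟩

theorem Below.trans (hM : IsPoGammaSemigroup op) {x y z : M} :
    Below op x y → Below op y z → Below op x z := by
  obtain ⟨assoc, mono_left, mono_right⟩ := hM
  rintro ⟨u, v, γ, μ, h⟩ ⟨u', v', γ', μ', h'⟩
  refine ⟨op γ u u', op μ v' v, γ', μ', ?_⟩
  have h'' := h.trans (mono_left _ _ v μ (mono_right _ _ u γ h'))
  simpa only [assoc] using h''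

theorem Below.le_right (hM : IsPoGammaSemigroup op) {x y z : M} (hyz : y ≤ z) :
    Below op x y → Below op x z := by
  rintro ⟨u, v, γ, μ, h⟩
  exact ⟨u, v, γ, μ, h.trans (hM.2.1 _ _ v μ (hM.2.2 _ _ u γ hyz))⟩

theorem Below.left_factor (hM : IsPoGammaSemigroup op) {x a b : M} {δ : Γ} :
    Below op x (op δ a b) → Below op x a := by
  rintro ⟨u, v, γ, μ, h⟩
  exact ⟨u, op μ b v, γ, δ, by simpa only [hM.1] using h⟩

theorem Below.right_factor (hM : IsPoGammaSemigroup op) {x a b : M} {δ : Γ} :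
    Below op x (op δ a b) → Below op x b := by
  rintro ⟨u, v, γ, μ, h⟩
  exact ⟨op γ u a, v, δ, μ, by simpa only [hM.1] using h⟩

theorem IsIntraRegular.below_square (hir : IsIntraRegular op) (x : M) (γ : Γ) :
    Below op x (op γ x x) := by
  obtain ⟨_, ⟨_, ⟨u, -, _, rfl, δ, rfl⟩, v, -, μ, rfl⟩, h⟩ := hir x γ
  exact ⟨u, v, δ, μ, h⟩

theorem Below.refl [Nonempty Γ] (hM : IsPoGammaSemigroup op) (hir : IsIntraRegular op) (x : M) :
    Below op x x :=
  (hir.below_square x (Classical.arbitrary Γ)).left_factor hM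

theorem Below.mul (hM : IsPoGammaSemigroup op) (hir : IsIntraRegular op)
    {x a b : M} (δ : Γ) (ha : Below op x a) (hb : Below op x b) :
    Below op x (op δ a b) := by
  obtain ⟨u, v, γ, μ, h⟩ := ha
  obtain ⟨u', v', γ', μ', h'⟩ := hb
  have hsq : Below op x (op γ (op μ' (op γ' u' b) v') (op μ (op γ u a) v)) :=
    ((hir.below_square x γ).le_right hM (hM.2.1 _ _ x γ h')).le_right hM (hM.2.2 _ _ _ γ h)
  have hba : Below op x (op γ (op μ' b (op γ v' u)) a) := by
    have hsq' : Below op x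
        (op γ' u' (op μ (op γ (op μ' b (op γ v' u)) a) v)) := by
      simpa only [hM.1] using hsq
    exact (hsq'.right_factor hM).left_factor hM
  refine hba.trans hM ?_
  have hs : Below op (op γ (op μ' b (op γ v' u)) a)
      (op μ' (op γ (op μ' b (op γ v' u)) (op δ a b)) (op γ (op γ v' u) a)) := by
    simpa only [hM.1] using hir.below_square (op γ (op μ' b (op γ v' u)) a) δ
  exact (hs.left_factor hM).right_factor hM

theorem Nfil_eq_below [Nonempty Γ] (hM : IsPoGammaSemigroup op) (hir : IsIntraRegular op) (x : M) :
    Nfil op x = {y | Below op x y} := by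
  apply Set.Subset.antisymm
  · refine Set.sInter_subset_of_mem ⟨⟨⟨⟨x, Below.refl hM hir x⟩, ?_⟩, ?_, ?_⟩, Below.refl hM hir x⟩
    · rintro _ ⟨a, ha, b, hb, γ, rfl⟩
      exact Below.mul hM hir γ ha hb
    · exact fun a b γ h => ⟨Below.left_factor hM h, Below.right_factor hM h⟩
    · exact fun a ha c hac => Below.le_right hM hac ha
  · rintro y ⟨u, v, γ, μ, h⟩ F ⟨⟨-, hfac, hup⟩, hx⟩
    exact (hfac _ _ _ (hfac _ _ _ (hup _ hx _ h)).1).2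

theorem mem_Ncls_iff [Nonempty Γ] (hM : IsPoGammaSemigroup op) (hir : IsIntraRegular op)
    {x y : M} : y ∈ Ncls op x ↔ Below op x y ∧ Below op y x := by
  rw [Ncls, Set.mem_ofPred_eq, Nfil_eq_below hM hir, Nfil_eq_below hM hir]
  constructor
  · intro h
    exact ⟨(Set.ext_iff.mp h y).mp (Below.refl hM hir y),
      (Set.ext_iff.mp h x).mpr (Below.refl hM hir x)⟩
  · rintro ⟨hxy, hyx⟩
    exact Set.ext fun z => ⟨hxy.trans hM, hyx.trans hM⟩

theorem isSimpleSub_Ncls [Nonempty Γ] (hM : IsPoGammaSemigroup op) (hir : IsIntraRegular op)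
    (x : M) : IsSimpleSub op (Ncls op x) := by
  refine ⟨⟨⟨x, rfl⟩, ?_⟩, ?_⟩
  · rintro _ ⟨a, ha, b, hb, γ, rfl⟩
    rw [mem_Ncls_iff hM hir] at *
    exact ⟨Below.mul hM hir γ ha.1 hb.1,
      ((Below.refl hM hir _).left_factor hM).trans hM ha.2⟩
  · rintro I ⟨⟨a, ha⟩, hsub, hleft, hright, hdown⟩
    refine Set.Subset.antisymm hsub fun b hb => ?_
    have hax := (mem_Ncls_iff hM hir).mp (hsub ha)
    have hbx := (mem_Ncls_iff hM hir).mp hb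
    have hba : Below op b a := hbx.2.trans hM hax.1
    let δ := Classical.arbitrary Γ
    obtain ⟨u, v, γ, μ, h⟩ := Below.mul hM hir δ (Below.mul hM hir δ hba hba) hba
    have hle : b ≤ op δ (op δ (op γ u a) a) (op μ a v) := by simpa only [hM.1] using h
    have hfac : Below op b (op δ (op δ (op γ u a) a) (op μ a v)) :=
      (Below.refl hM hir b).le_right hM hle
    have hua : op γ u a ∈ Ncls op x := (mem_Ncls_iff hM hir).mpr
      ⟨hbx.1.trans hM ((hfac.left_factor hM).left_factor hM),
        ((Below.refl hM hir _).right_factor hM).trans hM hax.2⟩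
    have hav : op μ a v ∈ Ncls op x := (mem_Ncls_iff hM hir).mpr
      ⟨hbx.1.trans hM (hfac.right_factor hM),
        ((Below.refl hM hir _).left_factor hM).trans hM hax.2⟩
    exact hdown _ (hright ⟨_, hleft ⟨_, hua, _, ha, δ, rfl⟩, _, hav, δ, rfl⟩) _ hb hle

theorem IsSimpleSub.below [Nonempty Γ] (hM : IsPoGammaSemigroup op) (hir : IsIntraRegular op)
    {T : Set M} (hT : IsSimpleSub op T) {a b : M} (ha : a ∈ T) (hb : b ∈ T) : Below op a b := by
  have hI : {t | t ∈ T ∧ Below op t b} = T := by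
    refine hT.2 _ ⟨⟨b, hb, Below.refl hM hir b⟩, fun t ht => ht.1, ?_, ?_, ?_⟩
    · rintro _ ⟨s, hs, t, ht, γ, rfl⟩
      exact ⟨hT.1.2 ⟨s, hs, t, ht.1, γ, rfl⟩,
        ((Below.refl hM hir _).right_factor hM).trans hM ht.2⟩
    · rintro _ ⟨t, ht, s, hs, γ, rfl⟩
      exact ⟨hT.1.2 ⟨t, ht.1, s, hs, γ, rfl⟩,
        ((Below.refl hM hir _).left_factor hM).trans hM ht.2⟩
    · exact fun t ht s hs hst => ⟨hs, ht.2.of_le hst⟩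
  exact (hI.symm.subset ha).2

theorem IsSimpleSub.subset_Ncls [Nonempty Γ] (hM : IsPoGammaSemigroup op)
    (hir : IsIntraRegular op) {T : Set M} (hT : IsSimpleSub op T) {a : M} (ha : a ∈ T) :
    T ⊆ Ncls op a := fun _ hb =>
  (mem_Ncls_iff hM hir).mpr ⟨hT.below hM hir ha hb, hT.below hM hir hb ha⟩

end Below

theorem statement_18 [PartialOrder M] [Nonempty M] [Nonempty Γ]
    (op : Γ → M → M → M) (hM : IsPoGammaSemigroup op)
    (hir : IsIntraRegular op) :
    {S : Set M | ∃ x : M, S = Ncls op x} =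
      {T : Set M | IsSimpleSub op T ∧
        ∀ T' : Set M, IsSimpleSub op T' → T ⊆ T' → T' = T} := by
  ext S
  constructor
  · rintro ⟨x, rfl⟩
    exact ⟨isSimpleSub_Ncls hM hir x, fun T' hT' hsub =>
      (hT'.subset_Ncls hM hir (hsub rfl)).antisymm hsub⟩
  · rintro ⟨hS, hmax⟩
    obtain ⟨a, ha⟩ := hS.1.1
    exact ⟨a, (hmax _ (isSimpleSub_Ncls hM hir a) (hS.subset_Ncls hM hir ha)).symm⟩

end PGS
end

section
/- Let M be a po-Γ-semigroup. The following are equivalent: (1) M is left regular and left duo; (2) N(x) = {y ∈ M : x ∈ (MΓ{y}]} for every x ∈ M; (3) 𝒩 = 𝓛, i.e., for all a,b ∈ M, N(a) = N(b) if and only if L(a) = L(b); (4) for every left ideal L of M, L = ⋃_{x ∈ L} (x)_𝒩; (5) (x)_𝒩 is a left simple subsemigroup of M for every x ∈ M; (6) M is a semilattice of left simple semigroups; (7) every left ideal of M is semiprime and is an ideal of M. -/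
namespace PGS

variable {M : Type*} {Γ : Type*}

section Filters

variable [PartialOrder M] {op : Γ → M → M → M}

theorem IsFilterSub.op_mem_iff {F : Set M} (hF : IsFilterSub op F) (a b : M) (γ : Γ) :
    op γ a b ∈ F ↔ a ∈ F ∧ b ∈ F :=
  ⟨hF.2.1 a b γ, fun h => hF.1.2 ⟨a, h.1, b, h.2, γ, rfl⟩⟩

theorem mem_Nfil_self (x : M) : x ∈ Nfil op x := fun _ hF => hF.2

theorem isFilterSub_Nfil (x : M) : IsFilterSub op (Nfil op x) := by
  refine ⟨⟨⟨x, mem_Nfil_self x⟩, ?_⟩, ?_, ?_⟩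
  · rintro _ ⟨a, ha, b, hb, γ, rfl⟩ F hF
    exact (hF.1.op_mem_iff a b γ).2 ⟨ha F hF, hb F hF⟩
  · intro a b γ h
    exact ⟨fun F hF => (hF.1.2.1 a b γ (h F hF)).1, fun F hF => (hF.1.2.1 a b γ (h F hF)).2⟩
  · intro a ha c hac F hF
    exact hF.1.2.2 a (ha F hF) c hac

theorem Nfil_eq_iff {a b : M} :
    Nfil op a = Nfil op b ↔ ∀ F : Set M, IsFilterSub op F → (a ∈ F ↔ b ∈ F) := by
  constructor
  · intro h F hF
    have hb : b ∈ Nfil op a := h ▸ mem_Nfil_self b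
    have ha : a ∈ Nfil op b := h ▸ mem_Nfil_self a
    exact ⟨fun haF => hb F ⟨hF, haF⟩, fun hbF => ha F ⟨hF, hbF⟩⟩
  · intro h
    ext y
    exact ⟨fun hy F hF => hy F ⟨hF.1, (h F hF.1).2 hF.2⟩,
      fun hy F hF => hy F ⟨hF.1, (h F hF.1).1 hF.2⟩⟩

theorem isSemilatticeCong_Nfil :
    IsSemilatticeCong op fun a b => Nfil op a = Nfil op b := by
  refine ⟨⟨fun _ => rfl, Eq.symm, Eq.trans⟩, ?_, ?_, ?_, ?_⟩
  · intro a b c γ h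
    rw [Nfil_eq_iff] at h ⊢
    intro F hF
    rw [hF.op_mem_iff, hF.op_mem_iff, h F hF]
  · intro a b c γ h
    rw [Nfil_eq_iff] at h ⊢
    intro F hF
    rw [hF.op_mem_iff, hF.op_mem_iff, h F hF]
  · intro a b γ
    rw [Nfil_eq_iff]
    intro F hF
    rw [hF.op_mem_iff, hF.op_mem_iff, and_comm]
  · intro a γ
    rw [Nfil_eq_iff]
    intro F hF
    rw [hF.op_mem_iff, and_self]

theorem isSubsemigroup_Ncls (x : M) : IsSubsemigroup op (Ncls op x) := by
  refine ⟨⟨x, rfl⟩, ?_⟩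
  rintro _ ⟨a, ha, b, hb, γ, rfl⟩
  refine Nfil_eq_iff.2 fun F hF => ?_
  rw [hF.op_mem_iff, Nfil_eq_iff.1 ha F hF, Nfil_eq_iff.1 hb F hF, and_self]

theorem mem_Nfil_of_mem_dcl {x y : M} (h : x ∈ dcl (gprod op Set.univ {y})) :
    y ∈ Nfil op x := by
  obtain ⟨_, ⟨m, -, _, rfl, γ, rfl⟩, hx⟩ := h
  have hF := isFilterSub_Nfil (op := op) x
  exact ((hF.op_mem_iff _ _ _).1 (hF.2.2 x (mem_Nfil_self x) _ hx)).2

theorem mem_Lgen_self (a : M) : a ∈ Lgen op a := ⟨a, Or.inl rfl, le_rfl⟩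

theorem mem_Nfil_of_mem_Lgen {a b : M} (h : a ∈ Lgen op b) : b ∈ Nfil op a := by
  obtain ⟨c, rfl | hc, hac⟩ := h
  · exact (isFilterSub_Nfil a).2.2 a (mem_Nfil_self a) _ hac
  · exact mem_Nfil_of_mem_dcl ⟨c, hc, hac⟩

theorem Nfil_subset_of_mem {a b : M} (h : b ∈ Nfil op a) : Nfil op b ⊆ Nfil op a :=
  fun _ hy => hy _ ⟨isFilterSub_Nfil a, h⟩

end Filters

section LeftIdeals

variable [PartialOrder M] {op : Γ → M → M → M}

theorem IsLeftIdeal.op_mem {L : Set M} (hL : IsLeftIdeal op L) {a : M} (ha : a ∈ L)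
    (m : M) (γ : Γ) : op γ m a ∈ L :=
  hL.1 ⟨m, trivial, a, ha, γ, rfl⟩

theorem IsRightIdeal.op_mem {R : Set M} (hR : IsRightIdeal op R) {a : M} (ha : a ∈ R)
    (m : M) (γ : Γ) : op γ a m ∈ R :=
  hR.1 ⟨a, ha, m, trivial, γ, rfl⟩

theorem IsLeftIdeal.dcl_gprod_subset {L : Set M} (hL : IsLeftIdeal op L) {a : M} (ha : a ∈ L) :
    dcl (gprod op Set.univ {a}) ⊆ L := by
  rintro x ⟨_, ⟨m, -, _, rfl, γ, rfl⟩, hx⟩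
  exact hL.2 _ (hL.op_mem ha m γ) x hx

theorem IsLeftIdeal.Lgen_subset {L : Set M} (hL : IsLeftIdeal op L) {a : M} (ha : a ∈ L) :
    Lgen op a ⊆ L := by
  rintro x ⟨c, rfl | hc, hx⟩
  · exact hL.2 _ ha x hx
  · exact hL.dcl_gprod_subset ha ⟨c, hc, hx⟩

theorem isLeftIdeal_dcl_gprod (hM : IsPoGammaSemigroup op) (a : M) :
    IsLeftIdeal op (dcl (gprod op Set.univ {a})) := by
  constructor
  · rintro _ ⟨k, -, x, ⟨_, ⟨m, -, a, rfl, γ, rfl⟩, hx⟩, μ, rfl⟩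
    refine ⟨op γ (op μ k m) a, ⟨_, trivial, a, rfl, γ, rfl⟩, ?_⟩
    rw [hM.1]
    exact hM.2.2 _ _ k μ hx
  · rintro x ⟨h, hh, hx⟩ y hy
    exact ⟨h, hh, hy.trans hx⟩

theorem isLeftIdeal_Lgen (hM : IsPoGammaSemigroup op) (a : M) :
    IsLeftIdeal op (Lgen op a) := by
  constructor
  · rintro _ ⟨k, -, x, ⟨c, rfl | hc, hx⟩, μ, rfl⟩
    · exact ⟨op μ k c, Or.inr ⟨k, trivial, c, rfl, μ, rfl⟩, hM.2.2 _ _ k μ hx⟩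
    · obtain ⟨d, hd, hle⟩ := (isLeftIdeal_dcl_gprod hM a).op_mem ⟨c, hc, hx⟩ k μ
      exact ⟨d, Or.inr hd, hle⟩
  · rintro x ⟨h, hh, hx⟩ y hy
    exact ⟨h, hh, hy.trans hx⟩

/-- A left ideal that is a union of classes of a semilattice congruence is a semiprime ideal. -/
theorem IsSemilatticeCong.semiprime_and_isIdeal {σ : M → M → Prop}
    (hσ : IsSemilatticeCong op σ) {L : Set M} (hL : IsLeftIdeal op L)
    (hsat : ∀ a ∈ L, ∀ y, σ y a → y ∈ L) : IsSemiprimeSubset op L ∧ IsIdeal op L := by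
  obtain ⟨heq, -, -, hcomm, hidem⟩ := hσ
  refine ⟨fun a γ h => hsat _ h a (heq.symm (hidem a γ)), hL, ?_, hL.2⟩
  rintro _ ⟨a, ha, m, -, γ, rfl⟩
  exact hsat _ (hL.op_mem ha m γ) _ (hcomm a m γ)

theorem IsSemiprimeSubset.op_swap_mem (hM : IsPoGammaSemigroup op) {T : Set M}
    (hT : IsSemiprimeSubset op T) (hI : IsIdeal op T) {a b : M} {γ : Γ} (h : op γ a b ∈ T)
    (δ : Γ) : op δ b a ∈ T := by
  apply hT _ γ
  have hba : op γ (op δ b a) (op δ b a) = op δ b (op δ (op γ a b) a) := by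
    rw [hM.1, hM.1]
  rw [hba]
  exact hI.1.op_mem (hI.2.op_mem h a δ) b δ

theorem mem_of_le_op_of_le_op (hM : IsPoGammaSemigroup op) {T : Set M}
    (hT : IsSemiprimeSubset op T) (hI : IsIdeal op T) {x y z m n : M} {μ ν γ : Γ}
    (hy : x ≤ op μ m y) (hz : x ≤ op ν n z) (h : op γ y z ∈ T) : x ∈ T := by
  have h₁ : op γ (op μ m y) z ∈ T := by
    rw [hM.1]
    exact hI.1.op_mem h m μ
  have h₂ : op γ (op ν n z) (op μ m y) ∈ T := by
    rw [hM.1]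
    exact hI.1.op_mem (hT.op_swap_mem hM hI h₁ γ) n ν
  exact hT x γ (hI.1.2 _ h₂ _ ((hM.2.1 _ _ _ γ hz).trans (hM.2.2 _ _ _ γ hy)))

end LeftIdeals

section LeftRegularLeftDuo

variable [PartialOrder M] {op : Γ → M → M → M}

theorem IsLeftRegular.isSemiprimeSubset (hreg : IsLeftRegular op) {L : Set M}
    (hL : IsLeftIdeal op L) : IsSemiprimeSubset op L :=
  fun a γ h => hL.dcl_gprod_subset h (hreg a γ)

theorem Nfil_eq_of_leftRegular_of_leftDuo [Nonempty Γ] (hM : IsPoGammaSemigroup op)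
    (hreg : IsLeftRegular op) (hduo : IsLeftDuo op) (x : M) :
    Nfil op x = {y : M | x ∈ dcl (gprod op Set.univ {y})} := by
  refine Set.Subset.antisymm ?_ fun y hy => mem_Nfil_of_mem_dcl hy
  have hx : x ∈ dcl (gprod op Set.univ {x}) := by
    obtain ⟨γ⟩ := ‹Nonempty Γ›
    obtain ⟨_, ⟨m, -, _, rfl, μ, rfl⟩, hle⟩ := hreg x γ
    exact ⟨_, ⟨op μ m x, trivial, x, rfl, γ, rfl⟩, by rwa [hM.1]⟩
  refine Set.sInter_subset_of_mem ⟨⟨⟨⟨x, hx⟩, ?_⟩, ?_, ?_⟩, hx⟩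
  · rintro _ ⟨y, ⟨_, ⟨m, -, y, rfl, μ, rfl⟩, hy⟩, z, ⟨_, ⟨n, -, z, rfl, ν, rfl⟩, hz⟩, γ, rfl⟩
    have hL := isLeftIdeal_dcl_gprod hM (op γ y z)
    have hT := hreg.isSemiprimeSubset hL
    have hyz : op γ y z ∈ dcl (gprod op Set.univ {op γ y z}) :=
      hT _ γ ⟨_, ⟨_, trivial, _, rfl, γ, rfl⟩, le_rfl⟩
    exact mem_of_le_op_of_le_op hM hT (hduo _ hL) hy hz hyz
  · rintro y z γ ⟨_, ⟨m, -, _, rfl, μ, rfl⟩, hle⟩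
    rw [← hM.1] at hle
    have hL := isLeftIdeal_dcl_gprod hM y
    refine ⟨hL.2 _ ((hduo _ hL).2.op_mem (a := op μ m y) ?_ z γ) x hle,
      ⟨_, ⟨_, trivial, z, rfl, γ, rfl⟩, hle⟩⟩
    exact ⟨_, ⟨m, trivial, y, rfl, μ, rfl⟩, le_rfl⟩
  · rintro y ⟨_, ⟨m, -, _, rfl, μ, rfl⟩, hle⟩ c hyc
    exact ⟨_, ⟨m, trivial, c, rfl, μ, rfl⟩, hle.trans (hM.2.2 _ _ m μ hyc)⟩

theorem Nfil_eq_iff_Lgen_eq (hM : IsPoGammaSemigroup op)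
    (h : ∀ x : M, Nfil op x = {y : M | x ∈ dcl (gprod op Set.univ {y})}) (a b : M) :
    Nfil op a = Nfil op b ↔ Lgen op a = Lgen op b := by
  have hsub : ∀ {a b : M}, Nfil op a = Nfil op b → Lgen op a ⊆ Lgen op b := by
    intro a b hab
    have hb : b ∈ Nfil op a := hab ▸ mem_Nfil_self b
    rw [h a] at hb
    exact (isLeftIdeal_Lgen hM b).Lgen_subset
      ((isLeftIdeal_Lgen hM b).dcl_gprod_subset (mem_Lgen_self b) hb)
  refine ⟨fun hab => (hsub hab).antisymm (hsub hab.symm), fun hab => ?_⟩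
  exact (Nfil_subset_of_mem (mem_Nfil_of_mem_Lgen (hab ▸ mem_Lgen_self b))).antisymm
    (Nfil_subset_of_mem (mem_Nfil_of_mem_Lgen (hab ▸ mem_Lgen_self a)))

theorem isLeftSimpleSub_Ncls [Nonempty Γ] (hM : IsPoGammaSemigroup op)
    (h : ∀ x : M, Nfil op x = {y : M | x ∈ dcl (gprod op Set.univ {y})}) (x : M) :
    IsLeftSimpleSub op (Ncls op x) := by
  refine ⟨isSubsemigroup_Ncls x, ?_⟩
  rintro I ⟨⟨y, hy⟩, hIsub, hIleft, hIdown⟩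
  refine hIsub.antisymm fun z hz => ?_
  obtain ⟨γ⟩ := ‹Nonempty Γ›
  have hzy : Nfil op z = Nfil op y := Eq.trans hz (hIsub hy).symm
  have hyz : op γ y y ∈ Nfil op z := by
    rw [hzy, (isFilterSub_Nfil y).op_mem_iff, and_self]
    exact mem_Nfil_self y
  rw [h z] at hyz
  obtain ⟨_, ⟨m, -, _, rfl, μ, rfl⟩, hle⟩ := hyz
  rw [← hM.1] at hle
  have hmy : op μ m y ∈ Ncls op x := by
    refine Eq.trans (Nfil_eq_iff.2 fun F hF => ⟨fun hmF => ?_, fun hzF => ?_⟩) hz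
    · exact (Nfil_eq_iff.1 hzy F hF).2 (hF.2.1 _ _ _ hmF).2
    · exact (hF.2.1 _ _ _ (hF.2.2 z hzF _ hle)).1
  exact hIdown _ (hIleft ⟨_, hmy, y, hy, γ, rfl⟩) z hz hle

theorem IsLeftIdeal.mem_of_isLeftSimpleSub {T L : Set M} (hT : IsLeftSimpleSub op T)
    (hL : IsLeftIdeal op L) {a y : M} (haT : a ∈ T) (haL : a ∈ L) (hy : y ∈ T) : y ∈ L := by
  have hLT : L ∩ T = T := by
    refine hT.2 _ ⟨⟨a, haL, haT⟩, Set.inter_subset_right, ?_, ?_⟩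
    · rintro _ ⟨b, hb, c, hc, γ, rfl⟩
      exact ⟨hL.op_mem hc.1 b γ, hT.1.2 ⟨b, hb, c, hc.2, γ, rfl⟩⟩
    · exact fun b hb c hc hcb => ⟨hL.2 b hb.1 c hcb, hc⟩
  exact (hLT.symm ▸ hy : y ∈ L ∩ T).1

theorem isLeftRegular_of_forall_isSemiprimeSubset (hM : IsPoGammaSemigroup op)
    (h : ∀ L : Set M, IsLeftIdeal op L → IsSemiprimeSubset op L) : IsLeftRegular op := by
  intro x γ
  have hT := h _ (isLeftIdeal_dcl_gprod hM (op γ x x))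
  exact hT x γ (hT _ γ ⟨_, ⟨_, trivial, _, rfl, γ, rfl⟩, le_rfl⟩)

end LeftRegularLeftDuo

theorem statement_19 [PartialOrder M] [Nonempty M] [Nonempty Γ]
    (op : Γ → M → M → M) (hM : IsPoGammaSemigroup op) :
    [IsLeftRegular op ∧ IsLeftDuo op,
      ∀ x : M, Nfil op x = {y : M | x ∈ dcl (gprod op Set.univ {y})},
      ∀ a b : M, Nfil op a = Nfil op b ↔ Lgen op a = Lgen op b,
      ∀ L : Set M, IsLeftIdeal op L → L = ⋃ x ∈ L, Ncls op x,
      ∀ x : M, IsLeftSimpleSub op (Ncls op x),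
      IsSemilatticeOfLeftSimple op,
      ∀ L : Set M, IsLeftIdeal op L →
        IsSemiprimeSubset op L ∧ IsIdeal op L].TFAE := by
  tfae_have 1 → 2 := fun h => Nfil_eq_of_leftRegular_of_leftDuo hM h.1 h.2
  tfae_have 2 → 3 := Nfil_eq_iff_Lgen_eq hM
  tfae_have 3 → 4 := by
    intro h L hL
    refine Set.Subset.antisymm (fun x hx => Set.mem_biUnion hx rfl) ?_
    refine Set.iUnion₂_subset fun x hx y hy => hL.Lgen_subset hx ?_
    exact (h y x).1 hy ▸ mem_Lgen_self y
  tfae_have 4 → 7 := by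
    intro h L hL
    refine isSemilatticeCong_Nfil.semiprime_and_isIdeal hL fun a ha y hy => ?_
    rw [h L hL]
    exact Set.mem_biUnion ha hy
  tfae_have 7 → 1 := fun h =>
    ⟨isLeftRegular_of_forall_isSemiprimeSubset hM fun L hL => (h L hL).1,
      fun L hL => (h L hL).2⟩
  tfae_have 2 → 5 := isLeftSimpleSub_Ncls hM
  tfae_have 5 → 6 := fun h => ⟨_, isSemilatticeCong_Nfil, h⟩
  tfae_have 6 → 7 := by
    rintro ⟨σ, hσ, h⟩ L hL
    exact hσ.semiprime_and_isIdeal hL fun a ha y hy =>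
      hL.mem_of_isLeftSimpleSub (h a) (hσ.1.refl a) ha hy
  tfae_finish

end PGS
end
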